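/- Let A_oct = {a ≥ 1 : a ≡ 1 (mod 8)}, A_even = {a ≥ 1 : a even}, and δ̄ = max(δ_{A_oct}, δ_{A_even}). If A is a finite set of positive integers with δ_A > δ̄, then A has no local obstructions: for every integer q ≥ 2 the reduction of D_A modulo q is all of ℤ/qℤ. -/

import Mathlib

open scoped ENNReal

/-- The generator matrix `[[0,1],[1,a]]`. -/
def cfGen (a : ℕ) : Matrix (Fin 2) (Fin 2) ℤ := !![0, 1; 1, (a : ℤ)]

/-- The semigroup `G_A`: all nonempty finite products of the generators
`[[0,1],[1,a]]` with `a ∈ A`. -/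
def GSemigroup (A : Set ℕ) : Set (Matrix (Fin 2) (Fin 2) ℤ) :=
  { M | ∃ l : List ℕ, l ≠ [] ∧ (∀ a ∈ l, a ∈ A) ∧ M = (l.map cfGen).prod }

/-- The set `D_A` of bottom-right entries of matrices in `G_A`. -/
def Denoms (A : Set ℕ) : Set ℕ :=
  { d | ∃ M ∈ GSemigroup A, M 1 1 = (d : ℤ) }

/-- `A` has no local obstructions if for every `q ≥ 2` the reduction of `D_A`
mod `q` is all of `ℤ/qℤ`. -/
def HasNoLocalObstructions (A : Set ℕ) : Prop :=
  ∀ q : ℕ, 2 ≤ q → ∀ r : ZMod q, ∃ d ∈ Denoms A, (d : ZMod q) = r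

/-- The Gauss map `x ↦ {1/x}`. -/
noncomputable def gaussMap (x : ℝ) : ℝ := Int.fract x⁻¹

/-- The `(n+1)`-st partial quotient of `x`. -/
noncomputable def partialQuot (x : ℝ) (n : ℕ) : ℤ := ⌊(gaussMap^[n] x)⁻¹⌋

/-- The Cantor-like set `C_A` of irrationals in `(0,1)` all of whose partial
quotients lie in `A`. -/
def cfCantorSet (A : Set ℕ) : Set ℝ :=
  { x | Irrational x ∧ x ∈ Set.Ioo (0 : ℝ) 1 ∧
      ∀ n : ℕ, ∃ a ∈ A, partialQuot x n = (a : ℤ) }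

/-- The alphabet `A_oct = {a ≥ 1 : a ≡ 1 (mod 8)}`. -/
def octAlphabet : Set ℕ := {a : ℕ | 1 ≤ a ∧ a % 8 = 1}

/-- The alphabet `A_even` of positive even integers. -/
def evenAlphabet : Set ℕ := {a : ℕ | 1 ≤ a ∧ a % 2 = 0}

/-- `x` is the sequence of complete quotients (tails) of the continued fraction with
digits `a`. -/
structure IsCFTail (a : ℕ → ℕ) (x : ℕ → ℝ) : Prop where
  digit_pos : ∀ k, 1 ≤ a k
  pos : ∀ k, 0 < x k
  lt_one : ∀ k, x k < 1
  inv_eq : ∀ k, (x k)⁻¹ = a k + x (k + 1)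

/-- The finite continued fraction `[0; a 0, …, a (n - 1)]`. -/
noncomputable def cfTrunc : ℕ → (ℕ → ℕ) → ℝ
  | 0, _ => 0
  | n + 1, a => ((a 0 : ℝ) + cfTrunc n fun k => a (k + 1))⁻¹

lemma cfTrunc_mem_Icc (n : ℕ) (a : ℕ → ℕ) (ha : ∀ k, 1 ≤ a k) :
    cfTrunc n a ∈ Set.Icc (0 : ℝ) 1 := by
  induction n generalizing a with
  | zero => simp [cfTrunc]
  | succ n ih =>
    have h := ih (fun k => a (k + 1)) fun k => ha _
    have h1 : (1 : ℝ) ≤ a 0 := by exact_mod_cast ha 0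
    have h2 := h.1
    rw [cfTrunc]
    exact ⟨by positivity, inv_le_one_of_one_le₀ (by linarith)⟩

lemma exists_isCFTail (a : ℕ → ℕ) (ha : ∀ k, 1 ≤ a k) : ∃ x, IsCFTail a x := by
  let Y : ℕ → ℕ → ℝ := fun N k => cfTrunc (N - k) fun j => a (k + j)
  have hY : ∀ N, Y N ∈ Set.univ.pi fun _ : ℕ => Set.Icc (0 : ℝ) 1 := fun N k _ =>
    cfTrunc_mem_Icc _ _ fun j => ha _
  have hc : IsCompact (Set.univ.pi fun _ : ℕ => Set.Icc (0 : ℝ) 1) :=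
    isCompact_univ_pi fun _ => isCompact_Icc
  obtain ⟨y, hy, ψ, hψ, hlim⟩ := hc.tendsto_subseq hY
  have h01 : ∀ k, y k ∈ Set.Icc (0 : ℝ) 1 := fun k => hy k trivial
  have hrec : ∀ k, y k * (a k + y (k + 1)) = 1 := by
    intro k
    have hk := fun j => (tendsto_pi_nhds.1 hlim) j
    have h1 := (hk k).mul ((hk (k + 1)).const_add (a k : ℝ))
    refine tendsto_nhds_unique h1 (tendsto_const_nhds.congr' ?_)
    filter_upwards [hψ.tendsto_atTop.eventually_gt_atTop k] with n hn
    obtain ⟨m, hm⟩ : ∃ m, ψ n = k + m + 1 := ⟨ψ n - k - 1, by omega⟩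
    have e1 : k + m + 1 - k = m + 1 := by omega
    have e2 : k + m + 1 - (k + 1) = m := by omega
    have e3 : (fun j => a (k + 1 + j)) = fun j => a (k + (j + 1)) := by
      funext j; congr 1; ring
    simp only [Function.comp, Y, hm, e1, e2, e3, cfTrunc, add_zero]
    have h := (cfTrunc_mem_Icc m (fun j => a (k + (j + 1))) fun j => ha _).1
    have h1 : (1 : ℝ) ≤ a k := by exact_mod_cast ha k
    rw [inv_mul_cancel₀]
    positivity
  have hpos : ∀ k, 0 < y k := fun k =>
    (h01 k).1.lt_of_ne fun h => by simpa [← h] using hrec k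
  refine ⟨y, ha, hpos, fun k => ?_, fun k => ?_⟩
  · have h1 : (1 : ℝ) ≤ a k := by exact_mod_cast ha k
    nlinarith [hrec k, hpos k, hpos (k + 1), mul_pos (hpos k) (hpos (k + 1))]
  · rw [eq_inv_of_mul_eq_one_left (hrec k), inv_inv]

namespace IsCFTail

variable {a b a' b' : ℕ → ℕ} {x y x' y' : ℕ → ℝ}

lemma mul_eq_one (h : IsCFTail a x) (k : ℕ) : x k * (a k + x (k + 1)) = 1 := by
  rw [← h.inv_eq, mul_inv_cancel₀ (h.pos k).ne']

lemma shift (h : IsCFTail a x) (n : ℕ) : IsCFTail (fun k => a (n + k)) fun k => x (n + k) :=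
  ⟨fun _ => h.digit_pos _, fun _ => h.pos _, fun _ => h.lt_one _, fun _ => h.inv_eq _⟩

lemma irrational (h : IsCFTail a x) : Irrational (x 0) := by
  suffices H : ∀ q : ℕ, ∀ p : ℕ, 0 < q → ∀ (a : ℕ → ℕ) (x : ℕ → ℝ), IsCFTail a x →
      x 0 * q ≠ p by
    rintro ⟨r, hr⟩
    have hr0 : (0 : ℝ) < r := by rw [hr]; exact h.pos 0
    have hr0' : 0 ≤ r := by exact_mod_cast hr0.le
    refine H r.den r.num.toNat r.den_pos a x h ?_
    rw [← hr]
    have h1 : ((r.num.toNat : ℤ) : ℝ) = (r.num : ℝ) := by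
      rw [Int.toNat_of_nonneg (Rat.num_nonneg.2 hr0')]
    have h2 := Rat.mul_den_eq_num r
    rw [← Int.cast_natCast r.num.toNat, h1]
    exact_mod_cast h2
  intro q
  induction q using Nat.strong_induction_on with
  | _ q ih =>
    intro p hq a x h hp
    have hq' : (0 : ℝ) < q := by exact_mod_cast hq
    have hp0 : (0 : ℝ) < p := by rw [← hp]; exact mul_pos (h.pos 0) hq'
    have hpq : (p : ℝ) < q := by rw [← hp]; nlinarith [h.lt_one 0]
    have key : x 1 * p = q - a 0 * p := by
      have := h.mul_eq_one 0
      rw [← hp]; simp only [zero_add] at this; linear_combination (q : ℝ) * this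
    have hle : a 0 * p ≤ q := by
      have : (0 : ℝ) ≤ x 1 * p := mul_nonneg (h.pos 1).le hp0.le
      have : (a 0 : ℝ) * p ≤ q := by linarith
      exact_mod_cast this
    refine ih p (by exact_mod_cast hpq) (q - a 0 * p) (by exact_mod_cast hp0) _ _ (h.shift 1) ?_
    push_cast [Nat.cast_sub hle]
    exact key

lemma iterate_gaussMap (h : IsCFTail a x) (n : ℕ) : gaussMap^[n] (x 0) = x n := by
  induction n with
  | zero => rfl
  | succ n ih =>
    rw [Function.iterate_succ_apply', ih, gaussMap, h.inv_eq, Int.fract_natCast_add]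
    exact Int.fract_eq_self.2 ⟨(h.pos _).le, h.lt_one _⟩

lemma mem_cfCantorSet (h : IsCFTail a x) {A : Set ℕ} (hA : ∀ k, a k ∈ A) :
    x 0 ∈ cfCantorSet A := by
  refine ⟨h.irrational, ⟨h.pos 0, h.lt_one 0⟩, fun n => ⟨a n, hA n, ?_⟩⟩
  rw [partialQuot, h.iterate_gaussMap, h.inv_eq, Int.floor_natCast_add,
    Int.floor_eq_zero_iff.2 ⟨(h.pos _).le, h.lt_one _⟩, add_zero]

lemma sub_abs_eq (h : IsCFTail a x) (h' : IsCFTail a' x') (k : ℕ) :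
    |x k - x' k| = x k * x' k * |(a k + x (k + 1)) - (a' k + x' (k + 1))| := by
  rw [← abs_of_pos (mul_pos (h.pos k) (h'.pos k)), ← abs_mul, abs_sub_comm]
  congr 1
  linear_combination x k * h'.mul_eq_one k - x' k * h.mul_eq_one k

lemma abs_sub_eq_prod (h : IsCFTail a x) (h' : IsCFTail a' x') (n : ℕ)
    (heq : ∀ k < n, a k = a' k) :
    |x 0 - x' 0| = (∏ k ∈ Finset.range n, x k) * (∏ k ∈ Finset.range n, x' k) *
      |x n - x' n| := by
  induction n with
  | zero => simp
  | succ n ih =>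
    rw [ih fun k hk => heq k (by omega), h.sub_abs_eq h' n, heq n (by omega),
      Finset.prod_range_succ, Finset.prod_range_succ, add_sub_add_left_eq_sub]
    ring

lemma abs_sub_le (h : IsCFTail a x) (h' : IsCFTail a' x') (k : ℕ) : |x k - x' k| ≤ 1 := by
  rw [abs_le]
  constructor <;> linarith [h.pos k, h'.pos k, h.lt_one k, h'.lt_one k]

lemma mul_succ_le (h : IsCFTail a x) (k : ℕ) : x k * x (k + 1) ≤ 1 / 2 := by
  have h1 : (1 : ℝ) ≤ a k := by exact_mod_cast h.digit_pos k
  nlinarith [h.mul_eq_one k, h.pos k, h.lt_one (k + 1), h.pos (k + 1)]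

lemma head_eq_of_digits_eq (h : IsCFTail a x) (h' : IsCFTail a x') : x 0 = x' 0 := by
  have H : ∀ n k, |x k - x' k| ≤ (1 / 4) ^ n := by
    intro n
    induction n with
    | zero => intro k; simpa using h.abs_sub_le h' k
    | succ n ih =>
      intro k
      rw [h.sub_abs_eq h' k, add_sub_add_left_eq_sub, h.sub_abs_eq h' (k + 1),
        add_sub_add_left_eq_sub, pow_succ']
      have e : x k * x' k * (x (k + 1) * x' (k + 1) * |x (k + 1 + 1) - x' (k + 1 + 1)|) =
        ((x k * x (k + 1)) * (x' k * x' (k + 1))) * |x (k + 1 + 1) - x' (k + 1 + 1)| := by ring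
      rw [e]
      refine mul_le_mul ?_ (ih _) (abs_nonneg _) (by norm_num)
      calc _ ≤ (1 / 2 : ℝ) * (1 / 2) := mul_le_mul (h.mul_succ_le k) (h'.mul_succ_le k)
            (mul_pos (h'.pos _) (h'.pos _)).le (by norm_num)
        _ = 1 / 4 := by norm_num
  have hl : Filter.Tendsto (fun n : ℕ => (1 / 4 : ℝ) ^ n) Filter.atTop (nhds 0) :=
    tendsto_pow_atTop_nhds_zero_of_lt_one (by norm_num) (by norm_num)
  have := ge_of_tendsto' hl fun n => H n 0
  exact sub_eq_zero.1 (abs_eq_zero.1 (le_antisymm this (abs_nonneg _)))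

lemma inv_prod_le (h : IsCFTail a x) (g : IsCFTail b y) (hba : ∀ k, b k ≤ a k) (n k : ℕ) :
    ∏ j ∈ Finset.range n, (y (k + j))⁻¹ ≤ 2 * ∏ j ∈ Finset.range n, (x (k + j))⁻¹ := by
  induction n using Nat.twoStepInduction generalizing k with
  | zero => norm_num
  | one =>
    have h1 : (1 : ℝ) ≤ a k := by exact_mod_cast h.digit_pos k
    have h2 : (b k : ℝ) ≤ a k := by exact_mod_cast hba k
    simp only [Finset.prod_range_one, add_zero, h.inv_eq, g.inv_eq]
    linarith [g.lt_one (k + 1), h.pos (k + 1)]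
  | more n ih0 ih1 =>
    have hrec : ∀ (a : ℕ → ℕ) (x : ℕ → ℝ), IsCFTail a x →
        ∏ j ∈ Finset.range (n + 2), (x (k + j))⁻¹ =
          a k * ∏ j ∈ Finset.range (n + 1), (x (k + 1 + j))⁻¹ +
            ∏ j ∈ Finset.range n, (x (k + 2 + j))⁻¹ := by
      intro a x h
      have e1 : ∀ j, x (k + (j + 1)) = x (k + 1 + j) := fun j => by congr 1; ring
      have e2 : ∀ j, x (k + 1 + (j + 1)) = x (k + 2 + j) := fun j => by congr 1; ring
      rw [Finset.prod_range_succ']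
      simp only [e1, add_zero]
      rw [h.inv_eq k, mul_add, mul_comm _ (a k : ℝ)]
      congr 1
      rw [Finset.prod_range_succ']
      simp only [e2, add_zero]
      rw [mul_assoc, inv_mul_cancel₀ (h.pos _).ne', mul_one]
    rw [hrec b y g, hrec a x h]
    have h2 : (b k : ℝ) ≤ a k := by exact_mod_cast hba k
    have hp : 0 ≤ ∏ j ∈ Finset.range (n + 1), (x (k + 1 + j))⁻¹ :=
      Finset.prod_nonneg fun j _ => (inv_pos.2 (h.pos _)).le
    have hb : (0 : ℝ) ≤ b k := by positivity
    nlinarith [ih0 (k + 2), mul_le_mul_of_nonneg_left (ih1 (k + 1)) hb,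
      mul_le_mul_of_nonneg_right h2 hp]

lemma prod_le (h : IsCFTail a x) (g : IsCFTail b y) (hba : ∀ k, b k ≤ a k) (n : ℕ) :
    ∏ j ∈ Finset.range n, x j ≤ 2 * ∏ j ∈ Finset.range n, y j := by
  have H := h.inv_prod_le g hba n 0
  simp only [zero_add, Finset.prod_inv_distrib] at H
  have hx : 0 < ∏ j ∈ Finset.range n, x j := Finset.prod_pos fun j _ => h.pos j
  have hy : 0 < ∏ j ∈ Finset.range n, y j := Finset.prod_pos fun j _ => g.pos j
  rw [← div_eq_mul_inv, inv_le_comm₀ hy (by positivity), inv_div, div_le_iff₀ two_pos] at H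
  linarith

lemma inv_le (g : IsCFTail b y) {M : ℕ} (hM : ∀ k, b k ≤ M) (k : ℕ) :
    ((M : ℝ) + 1)⁻¹ ≤ y k := by
  have h1 : (b k : ℝ) ≤ M := by exact_mod_cast hM k
  rw [inv_le_comm₀ (by positivity) (g.pos k), g.inv_eq]
  linarith [g.lt_one (k + 1)]

lemma le_one_sub (g : IsCFTail b y) {M : ℕ} (hM : ∀ k, b k ≤ M) (k : ℕ) :
    y k ≤ 1 - ((M : ℝ) + 2)⁻¹ := by
  have h1 : (1 : ℝ) ≤ b k := by exact_mod_cast g.digit_pos k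
  have h2 := g.inv_le hM (k + 1)
  have h3 := g.mul_eq_one k
  have hM0 : (0 : ℝ) < (M : ℝ) + 1 := by positivity
  have h4 : 1 ≤ y (k + 1) * (M + 1) := by
    rwa [inv_le_iff_one_le_mul₀ hM0] at h2
  have h5 : y k * (1 + y (k + 1)) ≤ 1 := by nlinarith [g.pos k]
  have h6 : y k * ((M : ℝ) + 2) ≤ M + 1 := by nlinarith [g.pos k]
  have h7 : (1 : ℝ) - ((M : ℝ) + 2)⁻¹ = (M + 1) / (M + 2) := by field_simp; ring
  rw [h7, le_div_iff₀ (by positivity)]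
  exact h6

lemma le_abs_sub (g : IsCFTail b y) (g' : IsCFTail b' y') {M : ℕ} (hM : ∀ k, b k ≤ M)
    (hM' : ∀ k, b' k ≤ M) {n : ℕ} (hn : b n ≠ b' n) :
    ((M : ℝ) + 1)⁻¹ * ((M : ℝ) + 1)⁻¹ * ((M : ℝ) + 2)⁻¹ ≤ |y n - y' n| := by
  rw [g.sub_abs_eq g']
  have hM0 : 0 ≤ ((M : ℝ) + 1)⁻¹ := by positivity
  refine mul_le_mul (mul_le_mul (g.inv_le hM n) (g'.inv_le hM' n) hM0 (g.pos n).le) ?_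
    (by positivity) (mul_pos (g.pos n) (g'.pos n)).le
  have hab := g.le_one_sub hM (n + 1)
  have hab' := g'.le_one_sub hM' (n + 1)
  have p := g.pos (n + 1)
  have p' := g'.pos (n + 1)
  rcases lt_or_gt_of_ne hn with hlt | hlt
  · have : (b n : ℝ) + 1 ≤ b' n := by exact_mod_cast hlt
    rw [abs_sub_comm]
    exact le_trans (by linarith) (le_abs_self _)
  · have : (b' n : ℝ) + 1 ≤ b n := by exact_mod_cast hlt
    exact le_trans (by linarith) (le_abs_self _)

/-- Lowering all digits by an injective relabelling shrinks distances at most by a constant. -/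
lemma abs_sub_le_mul (h : IsCFTail a x) (h' : IsCFTail a' x') (g : IsCFTail b y)
    (g' : IsCFTail b' y') (hba : ∀ k, b k ≤ a k) (hba' : ∀ k, b' k ≤ a' k)
    (hinj : ∀ k, b k = b' k ↔ a k = a' k) {M : ℕ} (hM : ∀ k, b k ≤ M) (hM' : ∀ k, b' k ≤ M) :
    |x 0 - x' 0| ≤ 4 * (M + 1) * (M + 1) * (M + 2) * |y 0 - y' 0| := by
  by_cases hall : ∀ k, a k = a' k
  · obtain rfl : a = a' := funext hall
    rw [h.head_eq_of_digits_eq h', sub_self, abs_zero]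
    positivity
  · push Not at hall
    classical
    set n := Nat.find hall
    have hn : a n ≠ a' n := Nat.find_spec hall
    have heq : ∀ k < n, a k = a' k := fun k hk => not_not.1 (Nat.find_min hall hk)
    rw [h.abs_sub_eq_prod h' n heq, g.abs_sub_eq_prod g' n fun k hk => (hinj k).2 (heq k hk)]
    have P := h.prod_le g hba n
    have P' := h'.prod_le g' hba' n
    have hx' : 0 ≤ ∏ k ∈ Finset.range n, x' k := Finset.prod_nonneg fun j _ => (h'.pos j).le
    have hy : 0 ≤ ∏ k ∈ Finset.range n, y k := Finset.prod_nonneg fun j _ => (g.pos j).le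
    have hy' : 0 ≤ ∏ k ∈ Finset.range n, y' k := Finset.prod_nonneg fun j _ => (g'.pos j).le
    have hD := g.le_abs_sub g' hM hM' fun e => hn ((hinj n).1 e)
    have hD1 : 1 ≤ ((M : ℝ) + 1) * (M + 1) * (M + 2) * |y n - y' n| := by
      refine le_trans (le_of_eq ?_) (mul_le_mul_of_nonneg_left hD (by positivity))
      field_simp
    have hPP := mul_le_mul P P' hx' (by positivity)
    calc _ ≤ (2 * ∏ k ∈ Finset.range n, y k) * (2 * ∏ k ∈ Finset.range n, y' k) * 1 :=
          mul_le_mul hPP (h.abs_sub_le h' n) (abs_nonneg _) (by positivity)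
      _ ≤ (2 * ∏ k ∈ Finset.range n, y k) * (2 * ∏ k ∈ Finset.range n, y' k) *
          (((M : ℝ) + 1) * (M + 1) * (M + 2) * |y n - y' n|) :=
          mul_le_mul_of_nonneg_left hD1 (by positivity)
      _ = _ := by ring

end IsCFTail

lemma exists_isCFTail_of_mem_cfCantorSet {A : Set ℕ} {x : ℝ} (hx : x ∈ cfCantorSet A) :
    ∃ a, (∀ k, a k ∈ A) ∧ IsCFTail a fun n => gaussMap^[n] x := by
  obtain ⟨hirr, h01, hd⟩ := hx
  choose a haA ha using hd
  have hI : ∀ n, Irrational (gaussMap^[n] x) := by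
    intro n
    induction n with
    | zero => exact hirr
    | succ n ih =>
      rw [Function.iterate_succ_apply', gaussMap, Int.fract]
      exact (irrational_inv_iff.2 ih).sub_intCast _
  have hb : ∀ n, 0 < gaussMap^[n] x ∧ gaussMap^[n] x < 1 := by
    intro n
    cases n with
    | zero => exact h01
    | succ n =>
      have h := hI (n + 1)
      rw [Function.iterate_succ_apply', gaussMap] at h ⊢
      exact ⟨(Int.fract_nonneg _).lt_of_ne h.ne_zero.symm, Int.fract_lt_one _⟩
  have hinv : ∀ n, (gaussMap^[n] x)⁻¹ = a n + gaussMap^[n + 1] x := by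
    intro n
    rw [Function.iterate_succ_apply', gaussMap, ← Int.cast_natCast (a n), ← ha n, partialQuot]
    exact (Int.floor_add_fract _).symm
  refine ⟨a, haA, fun k => ?_, fun k => (hb k).1, fun k => (hb k).2, hinv⟩
  have h1 : 1 < (gaussMap^[k] x)⁻¹ := (one_lt_inv₀ (hb k).1).2 (hb k).2
  rw [hinv] at h1
  have h2 : (0 : ℝ) < a k := by linarith [(hb (k + 1)).2]
  exact_mod_cast h2

/-- Lowering the digits of a finite alphabet does not decrease the Hausdorff dimension. -/
lemma dimH_cfCantorSet_le (A : Finset ℕ) (B : Set ℕ) (φ : ℕ → ℕ) (hinj : Set.InjOn φ A)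
    (hle : ∀ a ∈ A, φ a ≤ a) (hpos : ∀ a ∈ A, 1 ≤ φ a) (hB : ∀ a ∈ A, φ a ∈ B) :
    dimH (cfCantorSet ↑A) ≤ dimH (cfCantorSet B) := by
  have ex : ∀ x : cfCantorSet (A : Set ℕ), ∃ (a : ℕ → ℕ) (y : ℕ → ℝ), (∀ k, a k ∈ A) ∧
      IsCFTail a (fun n => gaussMap^[n] (x : ℝ)) ∧ IsCFTail (fun k => φ (a k)) y := by
    intro x
    obtain ⟨a, haA, ha⟩ := exists_isCFTail_of_mem_cfCantorSet x.2
    obtain ⟨y, hy⟩ := exists_isCFTail (fun k => φ (a k)) fun k => hpos _ (haA k)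
    exact ⟨a, y, haA, ha, hy⟩
  choose a y haA ha hy using ex
  obtain ⟨M, hM⟩ : ∃ M, ∀ c ∈ A, φ c ≤ M := ⟨A.sup φ, fun c hc => Finset.le_sup hc⟩
  have hanti : AntilipschitzWith (4 * (M + 1) * (M + 1) * (M + 2)) fun x => y x 0 := by
    refine AntilipschitzWith.of_le_mul_dist fun x x' => ?_
    rw [Subtype.dist_eq, Real.dist_eq, Real.dist_eq]
    have := (ha x).abs_sub_le_mul (ha x') (hy x) (hy x') (fun k => hle _ (haA x k))
      (fun k => hle _ (haA x' k)) (fun k => hinj.eq_iff (haA x k) (haA x' k))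
      (fun k => hM _ (haA x k)) (fun k => hM _ (haA x' k))
    simpa using this
  calc dimH (cfCantorSet ↑A) = dimH (Set.univ : Set (cfCantorSet (A : Set ℕ))) := by
        rw [← (isometry_subtype_coe (s := cfCantorSet (A : Set ℕ))).dimH_image]; simp
    _ ≤ dimH ((fun x => y x 0) '' Set.univ) := hanti.le_dimH_image _
    _ ≤ dimH (cfCantorSet B) := by
        refine dimH_mono ?_
        rintro _ ⟨x, -, rfl⟩
        exact (hy x).mem_cfCantorSet fun k => hB _ (haA x k)

lemma Submonoid.mem_of_mul_eq_one {M : Type*} [Monoid M] [Finite M] (S : Submonoid M) {a b : M}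
    (ha : a ∈ S) (hab : a * b = 1) (hba : b * a = 1) : b ∈ S := by
  let u : Mˣ := ⟨a, b, hab, hba⟩
  have h : u⁻¹ = u ^ (orderOf u - 1) :=
    inv_eq_of_mul_eq_one_right (by rw [mul_pow_sub_one (orderOf_pos u).ne', pow_orderOf_eq_one])
  have h' : b = a ^ (orderOf u - 1) := by simpa [u] using congrArg Units.val h
  exact h' ▸ pow_mem ha _

lemma cfGen_prod_nonneg (l : List ℕ) (i j : Fin 2) : 0 ≤ (l.map cfGen).prod i j := by
  induction l generalizing i j with
  | nil => fin_cases i <;> fin_cases j <;> simp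
  | cons a l ih =>
    rw [List.map_cons, List.prod_cons, Matrix.mul_apply]
    refine Finset.sum_nonneg fun k _ => mul_nonneg ?_ (ih k j)
    fin_cases i <;> fin_cases k <;> simp [cfGen]

/-- The monoid generated by the reductions of the generators modulo `q`. -/
def cfMonoid (A : Set ℕ) (q : ℕ) : Submonoid (Matrix (Fin 2) (Fin 2) (ZMod q)) :=
  Submonoid.closure ((fun a : ℕ => !![0, 1; 1, (a : ZMod q)]) '' A)

section Monoid

variable {A : Set ℕ} {q : ℕ}

lemma gen_mem_cfMonoid {a : ℕ} (ha : a ∈ A) : !![0, 1; 1, (a : ZMod q)] ∈ cfMonoid A q :=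
  Submonoid.subset_closure ⟨a, ha, rfl⟩

lemma gen_inv_mem_cfMonoid [NeZero q] {a : ℕ} (ha : a ∈ A) :
    !![-(a : ZMod q), 1; 1, 0] ∈ cfMonoid A q := by
  refine Submonoid.mem_of_mul_eq_one _ (gen_mem_cfMonoid ha) ?_ ?_ <;>
    simp [Matrix.one_fin_two]

lemma exists_list_of_mem_cfMonoid {M : Matrix (Fin 2) (Fin 2) (ZMod q)}
    (hM : M ∈ cfMonoid A q) : ∃ l : List ℕ, (∀ a ∈ l, a ∈ A) ∧
      M = (Int.castRingHom (ZMod q)).mapMatrix (l.map cfGen).prod := by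
  induction hM using Submonoid.closure_induction with
  | mem x hx =>
    obtain ⟨a, ha, rfl⟩ := hx
    refine ⟨[a], by simpa using ha, ?_⟩
    ext i j
    fin_cases i <;> fin_cases j <;> simp [cfGen]
  | one => exact ⟨[], by simp, by simp⟩
  | mul x y _ _ hx hy =>
    obtain ⟨l, hl, rfl⟩ := hx
    obtain ⟨l', hl', rfl⟩ := hy
    refine ⟨l ++ l', fun a ha => (List.mem_append.1 ha).elim (hl a) (hl' a), ?_⟩
    rw [List.map_append, List.prod_append, map_mul]

lemma exists_mem_Denoms [NeZero q] (hA : A.Nonempty) {M : Matrix (Fin 2) (Fin 2) (ZMod q)}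
    (hM : M ∈ cfMonoid A q) : ∃ d ∈ Denoms A, (d : ZMod q) = M 1 1 := by
  obtain ⟨c, hc⟩ := hA
  obtain ⟨l, hl, hlM⟩ := exists_list_of_mem_cfMonoid (mul_mem hM (gen_inv_mem_cfMonoid hc))
  have hN : M = (Int.castRingHom (ZMod q)).mapMatrix ((l ++ [c]).map cfGen).prod := by
    have h1 : (Int.castRingHom (ZMod q)).mapMatrix (cfGen c) = !![0, 1; 1, (c : ZMod q)] := by
      ext i j
      fin_cases i <;> fin_cases j <;> simp [cfGen]
    rw [List.map_append, List.prod_append, map_mul, ← hlM, List.map_singleton,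
      List.prod_singleton, h1, mul_assoc]
    simp [← Matrix.one_fin_two]
  refine ⟨(((l ++ [c]).map cfGen).prod 1 1).toNat, ⟨_, ⟨l ++ [c], by simp, fun a ha => ?_, rfl⟩,
    (Int.toNat_of_nonneg (cfGen_prod_nonneg _ _ _)).symm⟩, ?_⟩
  · rcases List.mem_append.1 ha with h | h
    · exact hl a h
    · rwa [List.mem_singleton.1 h]
  · rw [← Int.cast_natCast, Int.toNat_of_nonneg (cfGen_prod_nonneg _ _ _), hN]
    rfl

/-- The integers `t` such that the reduction of `[[1,t],[0,1]]` lies in the generated monoid. -/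
def shiftSubgroup (A : Set ℕ) (q : ℕ) [NeZero q] : AddSubgroup ℤ where
  carrier := {t | !![1, (t : ZMod q); 0, 1] ∈ cfMonoid A q}
  zero_mem' := by
    have := (cfMonoid A q).one_mem
    rw [Matrix.one_fin_two] at this
    simpa using this
  add_mem' {s t} hs ht := by
    change _ ∈ cfMonoid A q at hs ht
    have := mul_mem hs ht
    rw [Matrix.mul_fin_two] at this
    simpa [add_comm] using this
  neg_mem' {t} ht := by
    change _ ∈ cfMonoid A q at ht
    refine Submonoid.mem_of_mul_eq_one _ ht ?_ ?_ <;>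
      simp [Matrix.one_fin_two]

lemma sub_mem_shiftSubgroup [NeZero q] {a b : ℕ} (ha : a ∈ A) (hb : b ∈ A) :
    (b - a : ℤ) ∈ shiftSubgroup A q := by
  have := mul_mem (gen_inv_mem_cfMonoid (q := q) ha) (gen_mem_cfMonoid hb)
  rw [Matrix.mul_fin_two] at this
  simp only [mul_zero, mul_one, zero_add, one_mul, add_zero, zero_mul] at this
  change _ ∈ cfMonoid A q
  push_cast
  rwa [sub_eq_neg_add]

lemma exists_isUnit_add_mul (q : ℕ) [NeZero q] {a b : ℕ} [NeZero b] (hab : a.Coprime b) :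
    ∃ y : ZMod q, IsUnit ((a : ZMod q) + b * y) := by
  obtain ⟨p, hp, hpp, heq⟩ := Nat.forall_exists_prime_gt_and_eq_mod
    ((ZMod.isUnit_iff_coprime a b).2 hab) (max a q)
  have hap : a ≤ p := ((le_max_left _ _).trans_lt hp).le
  have hqp : q < p := (le_max_right _ _).trans_lt hp
  obtain ⟨k, hk⟩ := (Nat.modEq_iff_dvd' hap).1 ((ZMod.natCast_eq_natCast_iff _ _ _).1 heq.symm)
  refine ⟨k, ?_⟩
  have : (a : ZMod q) + b * k = (p : ℕ) := by
    rw [← Nat.cast_mul, ← hk, ← Nat.cast_add, Nat.add_sub_cancel' hap]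
  rw [this, ZMod.isUnit_iff_coprime]
  exact (hpp.coprime_iff_not_dvd).2 (Nat.not_dvd_of_pos_of_lt (NeZero.pos q) hqp)

lemma exists_mem_cfMonoid_of_one_mem_shift [NeZero q] {a : ℕ} (ha : a ∈ A)
    (h1 : (1 : ℤ) ∈ shiftSubgroup A q) (r : ZMod q) : ∃ M ∈ cfMonoid A q, M 1 1 = r := by
  obtain ⟨t, ht⟩ := ZMod.intCast_surjective (r - (a : ZMod q))
  have hU : t ∈ shiftSubgroup A q := by simpa using zsmul_mem h1 t
  refine ⟨_, mul_mem (gen_mem_cfMonoid ha) hU, ?_⟩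
  simp [ht]

lemma exists_mem_cfMonoid_of_one_mem [NeZero q] (h1 : 1 ∈ A) {m : ℕ} (hm2 : 2 ≤ m) (hm7 : m ≤ 7)
    (hm : (m : ℤ) ∈ shiftSubgroup A q) (r : ZMod q) : ∃ M ∈ cfMonoid A q, M 1 1 = r := by
  have hF : !![0, 1; 1, 1] ∈ cfMonoid A q := by simpa using gen_mem_cfMonoid (q := q) h1
  have hG : !![-1, 1; 1, 0] ∈ cfMonoid A q := by simpa using gen_inv_mem_cfMonoid (q := q) h1
  have hV : ∀ t : ZMod q, !![1, (m : ZMod q) * t; 0, 1] ∈ cfMonoid A q := by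
    intro t
    obtain ⟨s, rfl⟩ := ZMod.intCast_surjective t
    have : s * (m : ℤ) ∈ shiftSubgroup A q := by simpa using zsmul_mem hm s
    change _ ∈ cfMonoid A q at this
    simpa [mul_comm] using this
  have key : ∀ (t : ZMod q) (c : ℤ), c ∈ ({-3, -1, 0, 1, 2, 3} : Set ℤ) →
      ∃ M ∈ cfMonoid A q, M 1 1 = m * t + c := by
    intro t c hc
    simp only [Set.mem_insert_iff, Set.mem_singleton_iff] at hc
    rcases hc with rfl | rfl | rfl | rfl | rfl | rfl
    · refine ⟨_, mul_mem (mul_mem hG hG) (mul_mem (hV t) (mul_mem hG (mul_mem hG hG))), ?_⟩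
      simp
      ring
    · refine ⟨_, mul_mem hG (mul_mem (hV t) (mul_mem hG hG)), ?_⟩
      simp
      ring
    · refine ⟨_, mul_mem hF (mul_mem (hV t) (mul_mem hG hG)), ?_⟩
      simp
    · refine ⟨_, mul_mem hF (hV t), ?_⟩
      simp
    · refine ⟨_, mul_mem hF (mul_mem (hV t) hF), ?_⟩
      simp
      ring
    · refine ⟨_, mul_mem (mul_mem hF hF) (mul_mem (hV t) hF), ?_⟩
      simp
      ring
  obtain ⟨d, rfl⟩ := ZMod.intCast_surjective r
  have hd : ∃ t c : ℤ, d = m * t + c ∧ (c ∈ ({-3, -1, 0, 1, 2, 3} : Set ℤ) ∨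
      m = 6 ∧ c = 4 ∨ m = 7 ∧ c = 5) := by
    by_cases h : (m : ℤ) - 3 ≤ d % m ∧ d % m ≠ m - 2 ∧ 3 < d % m
    · refine ⟨d / m + 1, d % m - m, by linarith [Int.mul_ediv_add_emod d m], ?_⟩
      have := Int.emod_lt_of_pos d (by omega : (0 : ℤ) < m)
      left
      simp only [Set.mem_insert_iff, Set.mem_singleton_iff]
      omega
    · refine ⟨d / m, d % m, by linarith [Int.mul_ediv_add_emod d m], ?_⟩
      have h0 := Int.emod_nonneg d (by omega : (m : ℤ) ≠ 0)
      have := Int.emod_lt_of_pos d (by omega : (0 : ℤ) < m)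
      simp only [Set.mem_insert_iff, Set.mem_singleton_iff]
      omega
  obtain ⟨t, c, rfl, hc | ⟨rfl, rfl⟩ | ⟨rfl, rfl⟩⟩ := hd
  · simpa using key t c hc
  · obtain ⟨y, u, hu⟩ := exists_isUnit_add_mul q (a := 13) (b := 30) (by norm_num)
    have hF2 := mul_mem hF hF
    refine ⟨_, mul_mem hF2 (mul_mem (hV (↑u⁻¹ * (t - 5 - 15 * y))) (mul_mem hF2
      (mul_mem (hV y) (mul_mem hF2 hF2)))), ?_⟩
    have h := u.mul_inv
    rw [hu] at h
    simp
    push_cast at h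
    linear_combination 6 * (t - 5 - 15 * y) * h
  · obtain ⟨y, u, hu⟩ := exists_isUnit_add_mul q (a := 3) (b := 14) (by norm_num)
    refine ⟨_, mul_mem hF (mul_mem (hV (↑u⁻¹ * (t - 2 * y))) (mul_mem hF
      (mul_mem (hV y) (mul_mem hF hF)))), ?_⟩
    have h := u.mul_inv
    rw [hu] at h
    simp
    push_cast at h
    linear_combination 7 * (t - 2 * y) * h

end Monoid

/-- Compressing an alphabet contained in one class modulo `m` to one with common difference
`k ≤ m` does not decrease the Hausdorff dimension. -/
lemma dimH_cfCantorSet_le_of_dvd (A : Finset ℕ) (B : Set ℕ) {a₀ b₀ m k : ℕ}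
    (hmin : ∀ a ∈ A, a₀ ≤ a) (hdvd : ∀ a ∈ A, m ∣ a - a₀) (hb : 1 ≤ b₀)
    (hba : b₀ ≤ a₀) (hk : 0 < k) (hkm : m = 0 ∨ k ≤ m) (hB : ∀ n, b₀ + k * n ∈ B) :
    dimH (cfCantorSet ↑A) ≤ dimH (cfCantorSet B) := by
  refine dimH_cfCantorSet_le A B (fun a => b₀ + k * ((a - a₀) / m)) ?_ ?_ ?_ fun a _ => hB _
  · intro a ha b hb h
    have h1 : (a - a₀) / m = (b - a₀) / m := Nat.eq_of_mul_eq_mul_left hk (Nat.add_left_cancel h)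
    have h2 : a - a₀ = b - a₀ := by
      rw [← Nat.mul_div_cancel' (hdvd a ha), h1, Nat.mul_div_cancel' (hdvd b hb)]
    have := hmin a ha
    have := hmin b hb
    omega
  · intro a ha
    have h1 := hmin a ha
    have h2 : k * ((a - a₀) / m) ≤ a - a₀ := by
      rcases hkm with rfl | h
      · simp
      · exact (Nat.mul_le_mul_right _ h).trans (Nat.mul_div_le _ _)
    omega
  · intro a _
    omega

/-- A finite alphabet with Hausdorff dimension exceeding
`δ̄ = max(δ_{A_oct}, δ_{A_even})` has no local obstructions. -/
theorem no_local_obstructions_of_dimH_gt (A : Finset ℕ) (hpos : ∀ a ∈ A, 0 < a)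
    (hdim : dimH (cfCantorSet ↑A) >
      max (dimH (cfCantorSet octAlphabet)) (dimH (cfCantorSet evenAlphabet))) :
    HasNoLocalObstructions ↑A := by
  intro q hq r
  have : NeZero q := ⟨by omega⟩
  have hoct := not_le.2 ((le_max_left _ _).trans_lt hdim)
  have heven := not_le.2 ((le_max_right _ _).trans_lt hdim)
  have hne : A.Nonempty := by
    rw [Finset.nonempty_iff_ne_empty]
    rintro rfl
    exact hoct (dimH_cfCantorSet_le ∅ _ id (by simp) (by simp) (by simp) (by simp))
  suffices H : ∃ M ∈ cfMonoid (A : Set ℕ) q, M 1 1 = r by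
    obtain ⟨M, hM, rfl⟩ := H
    exact exists_mem_Denoms hne hM
  set a₀ := A.min' hne
  have ha₀ : a₀ ∈ A := A.min'_mem hne
  have hmin : ∀ a ∈ A, a₀ ≤ a := fun a ha => A.min'_le a ha
  have ha₀pos : 1 ≤ a₀ := hpos _ ha₀
  obtain ⟨g, hg⟩ := Int.subgroup_cyclic (shiftSubgroup (A : Set ℕ) q)
  rw [← AddSubgroup.zmultiples_eq_closure] at hg
  set m := g.natAbs
  have hmem : ∀ t, t ∈ shiftSubgroup (A : Set ℕ) q ↔ (m : ℤ) ∣ t := fun t => by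
    rw [hg, Int.mem_zmultiples_iff, Int.natAbs_dvd]
  have hdvd : ∀ a ∈ A, m ∣ a - a₀ := fun a ha => by
    have := (hmem _).1 (sub_mem_shiftSubgroup (q := q) (A := (A : Set ℕ)) ha₀ ha)
    rwa [← Nat.cast_sub (hmin a ha), Int.natCast_dvd_natCast] at this
  by_cases hm1 : m = 1
  · exact exists_mem_cfMonoid_of_one_mem_shift (A := (A : Set ℕ)) ha₀
      ((hmem 1).2 (by rw [hm1]; simp)) r
  have ha₀1 : a₀ = 1 := by
    by_contra h
    exact heven (dimH_cfCantorSet_le_of_dvd A _ (b₀ := 2) (k := 2) hmin hdvd (by omega) (by omega)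
      (by omega) (by omega) fun n => ⟨by omega, by omega⟩)
  have hm7 : m ≠ 0 ∧ m ≤ 7 := by
    by_contra h
    exact hoct (dimH_cfCantorSet_le_of_dvd A _ (b₀ := 1) (k := 8) hmin hdvd (by omega) (by omega)
      (by omega) (by omega) fun n => ⟨by omega, by omega⟩)
  exact exists_mem_cfMonoid_of_one_mem (by rw [← ha₀1]; exact ha₀) (by omega) hm7.2
    ((hmem _).2 dvd_rfl) r
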